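/- There exist constants C > 0 and K ≥ 0 such that for all sufficiently large real N, the number of ordered pairs (a, b) of positive integers with 1 < ab ≤ N, a² + b² prime, and P(ab) > N^{1/log log N} is at most C · N · (log log N)^K. -/

import Mathlib

open Real

/-- The largest prime factor of `n`, with the convention that `P(1) = 1`. -/
def maxPrimeFac (n : ℕ) : ℕ := if n ≤ 1 then 1 else n.primeFactors.sup id

theorem count_mul_add_of_periodic {P : ℕ → Prop} [DecidablePred P] {q : ℕ}
    (hP : ∀ n, P (q + n) ↔ P n) (t r : ℕ) :
    Nat.count P (q * t + r) = t * Nat.count P q + Nat.count P r := by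
  induction t with
  | zero => simp
  | succ t ih =>
    rw [show q * (t + 1) + r = q + (q * t + r) by ring, Nat.count_add]
    simp only [hP]
    rw [ih]
    ring

theorem abs_count_sub_le_of_periodic {P : ℕ → Prop} [DecidablePred P] {q : ℕ} (hq : 0 < q)
    (hP : ∀ n, P (q + n) ↔ P n) (X : ℕ) :
    |(Nat.count P X : ℝ) - X * (Nat.count P q / q)| ≤ Nat.count P q := by
  have hX := count_mul_add_of_periodic hP (X / q) (X % q)
  rw [Nat.div_add_mod] at hX
  have hr : Nat.count P (X % q) ≤ Nat.count P q := Nat.count_monotone P (Nat.mod_lt X hq).le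
  have hX' : (X : ℝ) = q * (X / q : ℕ) + (X % q : ℕ) := by exact_mod_cast (Nat.div_add_mod X q).symm
  have hq' : (0 : ℝ) < q := by exact_mod_cast hq
  have hlt : ((X % q : ℕ) : ℝ) ≤ q := by exact_mod_cast (Nat.mod_lt X hq).le
  have hfrac : ((X % q : ℕ) : ℝ) / q ≤ 1 := (div_le_one hq').2 hlt
  have hfrac0 : 0 ≤ ((X % q : ℕ) : ℝ) / q := by positivity
  have hr' : (Nat.count P (X % q) : ℝ) ≤ Nat.count P q := by exact_mod_cast hr
  have hc : (0 : ℝ) ≤ Nat.count P q := by positivity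
  have hc' : (0 : ℝ) ≤ Nat.count P (X % q) := by positivity
  have key : (Nat.count P X : ℝ) - X * (Nat.count P q / q) =
      Nat.count P (X % q) - ((X % q : ℕ) : ℝ) / q * Nat.count P q := by
    rw [hX, hX']
    push_cast
    field_simp
    ring
  rw [key, abs_le]
  constructor <;> nlinarith

theorem count_and_of_periodic {P Q : ℕ → Prop} [DecidablePred P] [DecidablePred Q] {a b : ℕ}
    (hab : a.Coprime b) (ha : 0 < a) (hb : 0 < b)
    (hP : ∀ n, P (n % a) ↔ P n) (hQ : ∀ n, Q (n % b) ↔ Q n) :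
    Nat.count (fun n ↦ P n ∧ Q n) (a * b) = Nat.count P a * Nat.count Q b := by
  simp only [Nat.count_eq_card_filter_range]
  rw [← Finset.card_product]
  refine Finset.card_bij (fun n _ ↦ (n % a, n % b)) ?_ ?_ ?_
  · intro n hn
    simp only [Finset.mem_filter, Finset.mem_range, Finset.mem_product] at hn ⊢
    exact ⟨⟨Nat.mod_lt _ ha, (hP n).2 hn.2.1⟩, ⟨Nat.mod_lt _ hb, (hQ n).2 hn.2.2⟩⟩
  · intro m hm n hn h
    simp only [Finset.mem_filter, Finset.mem_range, Prod.mk.injEq] at hm hn h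
    have := (Nat.modEq_and_modEq_iff_modEq_mul hab).1 h
    exact this.eq_of_lt_of_lt hm.1 hn.1
  · rintro ⟨x, y⟩ h
    simp only [Finset.mem_filter, Finset.mem_range, Finset.mem_product] at h
    obtain ⟨⟨hx, hPx⟩, hy, hQy⟩ := h
    have h1 := (Nat.chineseRemainder hab x y).2.1
    have h2 := (Nat.chineseRemainder hab x y).2.2
    have h1' : (Nat.chineseRemainder hab x y : ℕ) % a = x := Nat.mod_eq_of_modEq h1 hx
    have h2' : (Nat.chineseRemainder hab x y : ℕ) % b = y := Nat.mod_eq_of_modEq h2 hy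
    refine ⟨Nat.chineseRemainder hab x y, ?_, Prod.ext h1' h2'⟩
    simp only [Finset.mem_filter, Finset.mem_range]
    refine ⟨Nat.chineseRemainder_lt_mul hab x y ha.ne' hb.ne', ?_, ?_⟩
    · rwa [← hP, h1']
    · rwa [← hQ, h2']

theorem count_mem_zmod {q : ℕ} (hq : 0 < q) (A : Finset (ZMod q)) :
    Nat.count (fun n : ℕ ↦ (n : ZMod q) ∈ A) q = A.card := by
  have : NeZero q := ⟨hq.ne'⟩
  rw [Nat.count_eq_card_filter_range]
  refine Finset.card_bij (fun n _ ↦ (n : ZMod q)) ?_ ?_ ?_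
  · intro n hn
    exact (Finset.mem_filter.1 hn).2
  · intro m hm n hn h
    simp only [Finset.mem_filter, Finset.mem_range] at hm hn
    exact ((ZMod.natCast_eq_natCast_iff _ _ _).1 h).eq_of_lt_of_lt hm.1 hn.1
  · intro x hx
    exact ⟨x.val, by simpa using ⟨x.val_lt, hx⟩, by simp⟩

theorem count_forall_mem_zmod (Ω : (l : ℕ) → Finset (ZMod l)) (D : Finset ℕ)
    (hD : ∀ l ∈ D, l.Prime) :
    Nat.count (fun n : ℕ ↦ ∀ l ∈ D, (n : ZMod l) ∈ Ω l) (∏ l ∈ D, l) = ∏ l ∈ D, (Ω l).card := by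
  induction D using Finset.induction_on with
  | empty => simp
  | insert p D hp ih =>
    have hpp := hD p (Finset.mem_insert_self _ _)
    have hDp : ∀ l ∈ D, l.Prime := fun l hl ↦ hD l (Finset.mem_insert_of_mem hl)
    rw [Finset.prod_insert hp, Finset.prod_insert hp, ← ih hDp, ← count_mem_zmod hpp.pos (Ω p),
      ← count_and_of_periodic (P := fun n : ℕ ↦ (n : ZMod p) ∈ Ω p)
        (Q := fun n : ℕ ↦ ∀ l ∈ D, (n : ZMod l) ∈ Ω l) _ hpp.pos
        (Finset.prod_pos fun l hl ↦ (hDp l hl).pos)]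
    · simp only [Finset.forall_mem_insert]
    · intro n
      rw [ZMod.natCast_mod]
    · intro n
      refine forall₂_congr fun l hl ↦ ?_
      rw [(ZMod.natCast_eq_natCast_iff (n % ∏ l ∈ D, l) n l).2
        ((Nat.mod_modEq _ _).of_dvd (Finset.dvd_prod_of_mem _ hl))]
    · refine Nat.Coprime.prod_right fun l hl ↦ (Nat.coprime_primes hpp (hDp l hl)).2 ?_
      rintro rfl
      exact hp hl

theorem abs_count_forall_mem_zmod_sub_le (Ω : (l : ℕ) → Finset (ZMod l)) (D : Finset ℕ)
    (hD : ∀ l ∈ D, l.Prime) (X : ℕ) :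
    |(Nat.count (fun n : ℕ ↦ ∀ l ∈ D, (n : ZMod l) ∈ Ω l) X : ℝ)
        - X * ∏ l ∈ D, ((Ω l).card / l : ℝ)| ≤ ∏ l ∈ D, ((Ω l).card : ℝ) := by
  have h := abs_count_sub_le_of_periodic (P := fun n : ℕ ↦ ∀ l ∈ D, (n : ZMod l) ∈ Ω l)
    (Finset.prod_pos fun l hl ↦ (hD l hl).pos) ?_ X
  · rw [count_forall_mem_zmod Ω D hD] at h
    simpa [Finset.prod_div_distrib] using h
  · intro n
    refine forall₂_congr fun l hl ↦ ?_
    have : ((∏ l ∈ D, l : ℕ) : ZMod l) = 0 :=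
      (ZMod.natCast_eq_zero_iff _ _).2 (Finset.dvd_prod_of_mem _ hl)
    rw [Nat.cast_add, this, zero_add]

theorem ite_eq_empty_le_sum_powerset_filter {α : Type*} [DecidableEq α] (T : Finset α) (k : ℕ) :
    (if T = ∅ then 1 else 0 : ℝ) ≤
      ∑ D ∈ T.powerset with D.card ≤ 2 * k, (-1 : ℝ) ^ D.card := by
  rcases Finset.eq_empty_or_nonempty T with rfl | hT
  · simp [Finset.filter_singleton]
  · rw [if_neg hT.ne_empty]
    have h : ∑ D ∈ T.powerset with D.card ≤ 2 * k, (-1 : ℝ) ^ D.card =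
        ∑ j ∈ Finset.range (2 * k + 1), (-1 : ℝ) ^ j * (T.card.choose j) := by
      rw [← Finset.sum_fiberwise_of_maps_to (g := Finset.card)
        (t := Finset.range (2 * k + 1)) (fun D hD ↦ by
          have := (Finset.mem_filter.1 hD).2
          simp only [Finset.mem_range]
          omega)]
      refine Finset.sum_congr rfl fun j hj ↦ ?_
      rw [← Finset.card_powersetCard, mul_comm ((-1 : ℝ) ^ j), ← nsmul_eq_mul, ← Finset.sum_const]
      refine Finset.sum_congr ?_ fun D hD ↦ by rw [(Finset.mem_powersetCard.1 hD).2]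
      ext D
      simp only [Finset.mem_filter, Finset.mem_powerset, Finset.mem_powersetCard, Finset.mem_range]
        at hj ⊢
      constructor
      · rintro ⟨⟨h1, -⟩, h2⟩
        exact ⟨h1, h2⟩
      · rintro ⟨h1, h2⟩
        exact ⟨⟨h1, by omega⟩, h2⟩
    obtain ⟨t, ht⟩ := Nat.exists_eq_succ_of_ne_zero hT.card_pos.ne'
    have h2 := Int.alternating_sum_range_choose_eq_choose (n := t) (m := 2 * k)
    have h3 : ∑ j ∈ Finset.range (2 * k + 1), (-1 : ℝ) ^ j * (T.card.choose j) = t.choose (2 * k) := by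
      rw [ht]
      have h4 := congrArg (Int.cast : ℤ → ℝ) h2
      push_cast at h4
      simpa [pow_mul] using h4
    rw [h, h3]
    positivity

theorem sum_powerset_filter_card_gt_le {α : Type*} [DecidableEq α] (Q : Finset α) (g : α → ℝ)
    (hg : ∀ a ∈ Q, 0 ≤ g a) (k : ℕ) :
    ∑ D ∈ Q.powerset with ¬ D.card ≤ k, ∏ a ∈ D, g a ≤ exp (3 * ∑ a ∈ Q, g a - k) := by
  have hg' : ∀ D ∈ Q.powerset, 0 ≤ ∏ a ∈ D, g a := fun D hD ↦
    Finset.prod_nonneg fun a ha ↦ hg a (Finset.mem_powerset.1 hD ha)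
  calc ∑ D ∈ Q.powerset with ¬ D.card ≤ k, ∏ a ∈ D, g a
      ≤ ∑ D ∈ Q.powerset with ¬ D.card ≤ k, exp (-k) * ∏ a ∈ D, (exp 1 * g a) := by
        refine Finset.sum_le_sum fun D hD ↦ ?_
        rw [Finset.mem_filter, not_le] at hD
        rw [Finset.prod_mul_distrib, Finset.prod_const, ← exp_nat_mul, ← mul_assoc, ← exp_add]
        refine le_mul_of_one_le_left (hg' D hD.1) (one_le_exp ?_)
        have : (k : ℝ) < D.card := by exact_mod_cast hD.2
        linarith
    _ ≤ ∑ D ∈ Q.powerset, exp (-k) * ∏ a ∈ D, (exp 1 * g a) := by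
        refine Finset.sum_le_sum_of_subset_of_nonneg (Finset.filter_subset _ _) fun D hD _ ↦ ?_
        refine mul_nonneg (exp_pos _).le (Finset.prod_nonneg fun a ha ↦ mul_nonneg (exp_pos _).le
          (hg a (Finset.mem_powerset.1 hD ha)))
    _ = exp (-k) * ∏ a ∈ Q, (1 + exp 1 * g a) := by
        rw [← Finset.mul_sum, Finset.prod_one_add]
    _ ≤ exp (-k) * exp (∑ a ∈ Q, 3 * g a) := by
        gcongr
        rw [exp_sum]
        refine Finset.prod_le_prod (fun a ha ↦ ?_) fun a ha ↦ ?_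
        · have := mul_nonneg (exp_pos 1).le (hg a ha)
          linarith
        · have h1 := add_one_le_exp (3 * g a)
          have h2 := mul_le_mul_of_nonneg_right exp_one_lt_three.le (hg a ha)
          linarith
    _ = exp (3 * ∑ a ∈ Q, g a - k) := by
        rw [← exp_add, ← Finset.mul_sum]
        ring_nf

theorem sum_powerset_filter_card_le_prod_le {Q : Finset ℕ} {z : ℕ} (hz : 0 < z) (hQ : Q.card ≤ z)
    (w : ℕ → ℝ) (hw : ∀ l ∈ Q, 0 ≤ w l) (hw' : ∀ l ∈ Q, w l ≤ 3) (k : ℕ) :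
    ∑ D ∈ Q.powerset with D.card ≤ k, ∏ l ∈ D, w l ≤ exp 3 * (z : ℝ) ^ k := by
  have hz0 : (0 : ℝ) < z := by exact_mod_cast hz
  have hz1 : (1 : ℝ) ≤ z := by exact_mod_cast hz
  calc ∑ D ∈ Q.powerset with D.card ≤ k, ∏ l ∈ D, w l
      ≤ ∑ D ∈ Q.powerset with D.card ≤ k, (z : ℝ) ^ k * ∏ l ∈ D, (w l / z) := by
        refine Finset.sum_le_sum fun D hD ↦ ?_
        rw [Finset.mem_filter, Finset.mem_powerset] at hD
        rw [Finset.prod_div_distrib, Finset.prod_const, mul_div_assoc', mul_comm, mul_div_assoc]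
        refine le_mul_of_one_le_right (Finset.prod_nonneg fun l hl ↦ hw l (hD.1 hl)) ?_
        rw [one_le_div (by positivity)]
        exact pow_le_pow_right₀ hz1 hD.2
    _ ≤ ∑ D ∈ Q.powerset, (z : ℝ) ^ k * ∏ l ∈ D, (w l / z) := by
        refine Finset.sum_le_sum_of_subset_of_nonneg (Finset.filter_subset _ _) fun D hD _ ↦ ?_
        exact mul_nonneg (by positivity) (Finset.prod_nonneg fun l hl ↦
          div_nonneg (hw l (Finset.mem_powerset.1 hD hl)) hz0.le)
    _ = (z : ℝ) ^ k * ∏ l ∈ Q, (1 + w l / z) := by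
        rw [← Finset.mul_sum, Finset.prod_one_add]
    _ ≤ (z : ℝ) ^ k * ∏ l ∈ Q, exp (3 / z) := by
        gcongr with l hl
        · exact fun l hl ↦ add_nonneg zero_le_one (div_nonneg (hw l hl) hz0.le)
        · have h1 := add_one_le_exp (3 / (z : ℝ))
          have h2 : w l / z ≤ 3 / z := by gcongr; exact hw' l hl
          linarith
    _ ≤ exp 3 * (z : ℝ) ^ k := by
        rw [Finset.prod_const, ← exp_nat_mul, mul_comm]
        gcongr
        rw [mul_div_assoc', div_le_iff₀ hz0, mul_comm]
        gcongr

/-- Brun's pure sieve, as an upper bound. -/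
theorem count_forall_notMem_zmod_le (Ω : (l : ℕ) → Finset (ZMod l)) (Q : Finset ℕ)
    (hQ : ∀ l ∈ Q, l.Prime) {z : ℕ} (hz : 0 < z) (hQz : Q.card ≤ z)
    (hΩ : ∀ l ∈ Q, (Ω l).card ≤ 3) (hΩ' : ∀ l ∈ Q, (Ω l).card ≤ l) (X k : ℕ) :
    (Nat.count (fun n : ℕ ↦ ∀ l ∈ Q, (n : ZMod l) ∉ Ω l) X : ℝ) ≤
      X * (exp (-∑ l ∈ Q, ((Ω l).card / l : ℝ)) +
        exp (3 * ∑ l ∈ Q, ((Ω l).card / l : ℝ) - 2 * k)) + exp 3 * (z : ℝ) ^ (2 * k) := by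
  set g : ℕ → ℝ := fun l ↦ (Ω l).card / l with hg
  have hg0 : ∀ l, 0 ≤ g l := fun l ↦ by positivity
  set F := Q.powerset.filter fun D ↦ D.card ≤ 2 * k with hF
  have hFQ : ∀ D ∈ F, D ⊆ Q := fun D hD ↦ Finset.mem_powerset.1 (Finset.mem_filter.1 hD).1
  set A : Finset ℕ → ℝ := fun D ↦
    Nat.count (fun n : ℕ ↦ ∀ l ∈ D, (n : ZMod l) ∈ Ω l) X with hA
  have h1 : (Nat.count (fun n : ℕ ↦ ∀ l ∈ Q, (n : ZMod l) ∉ Ω l) X : ℝ) ≤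
      ∑ D ∈ F, (-1) ^ D.card * A D := by
    simp only [hA, Nat.count_eq_card_filter_range, Finset.card_filter, Nat.cast_sum, Finset.mul_sum]
    rw [Finset.sum_comm]
    refine Finset.sum_le_sum fun n _ ↦ ?_
    have h2 := ite_eq_empty_le_sum_powerset_filter (Q.filter fun l ↦ (n : ZMod l) ∈ Ω l) k
    simp only [Finset.filter_eq_empty_iff] at h2
    push_cast
    refine h2.trans_eq ?_
    simp only [mul_ite, mul_one, mul_zero]
    rw [← Finset.sum_filter]
    refine Finset.sum_congr ?_ fun _ _ ↦ rfl
    ext D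
    simp only [hF, Finset.mem_filter, Finset.mem_powerset, Finset.subset_iff]
    grind
  have h2 : ∑ D ∈ F, (-1) ^ D.card * A D ≤
      ∑ D ∈ F, (X * ((-1) ^ D.card * ∏ l ∈ D, g l) + ∏ l ∈ D, ((Ω l).card : ℝ)) := by
    refine Finset.sum_le_sum fun D hD ↦ ?_
    have h3 := abs_le.1 (abs_count_forall_mem_zmod_sub_le Ω D (fun l hl ↦ hQ l (hFQ D hD hl)) X)
    rcases neg_one_pow_eq_or ℝ D.card with h | h <;> rw [h] <;> simp only [hA, hg] <;> linarith
  have h3 : ∑ D ∈ F, (-1) ^ D.card * ∏ l ∈ D, g l ≤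
      exp (-∑ l ∈ Q, g l) + exp (3 * ∑ l ∈ Q, g l - 2 * k) := by
    have h4 : ∑ D ∈ F, (-1) ^ D.card * ∏ l ∈ D, g l =
        ∏ l ∈ Q, (1 - g l) -
          ∑ D ∈ Q.powerset with ¬ D.card ≤ 2 * k, (-1) ^ D.card * ∏ l ∈ D, g l := by
      rw [eq_sub_iff_add_eq, Finset.sum_filter_add_sum_filter_not, Finset.prod_sub]
      simp [mul_comm]
    have h5 : ∏ l ∈ Q, (1 - g l) ≤ exp (-∑ l ∈ Q, g l) := by
      rw [← Finset.sum_neg_distrib, exp_sum]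
      refine Finset.prod_le_prod (fun l hl ↦ ?_) fun l hl ↦ one_sub_le_exp_neg _
      have : (0 : ℝ) < l := by exact_mod_cast (hQ l hl).pos
      rw [sub_nonneg, hg]
      exact (div_le_one this).2 (by exact_mod_cast hΩ' l hl)
    have h6 := sum_powerset_filter_card_gt_le Q g (fun l _ ↦ hg0 l) (2 * k)
    have h7 : -∑ D ∈ Q.powerset with ¬ D.card ≤ 2 * k, (-1) ^ D.card * ∏ l ∈ D, g l ≤
        ∑ D ∈ Q.powerset with ¬ D.card ≤ 2 * k, ∏ l ∈ D, g l := by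
      rw [← Finset.sum_neg_distrib]
      refine Finset.sum_le_sum fun D _ ↦ ?_
      have : 0 ≤ ∏ l ∈ D, g l := Finset.prod_nonneg fun l _ ↦ hg0 l
      rcases neg_one_pow_eq_or ℝ D.card with h | h <;> rw [h] <;> linarith
    push_cast at h6
    linarith
  have h4 := sum_powerset_filter_card_le_prod_le hz hQz (fun l ↦ ((Ω l).card : ℝ))
    (fun _ _ ↦ by positivity) (fun l hl ↦ by exact_mod_cast hΩ l hl) (2 * k)
  rw [Finset.sum_add_distrib, ← Finset.mul_sum] at h2
  have h5 := mul_le_mul_of_nonneg_left h3 (Nat.cast_nonneg (α := ℝ) X)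
  linarith

theorem sum_primesLE_two_pow_inv_le (J : ℕ) :
    ∑ p ∈ Nat.primesLE (2 ^ (J + 1)), (1 / p : ℝ) ≤ 1 / 2 + 4 * ∑ j ∈ Finset.Icc 1 J, (j : ℝ)⁻¹ := by
  induction J with
  | zero =>
    have : Nat.primesLE (2 ^ (0 + 1)) = {2} := by decide
    rw [this]
    norm_num
  | succ J ih =>
    set n := 2 ^ (J + 1) with hn
    have hlog : (0 : ℝ) < log 2 := log_pos one_lt_two
    have hn0 : (0 : ℝ) < n := by positivity
    have hlogn : log n = (J + 1) * log 2 := by rw [hn]; simp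
    have h1 : ∑ p ∈ Nat.primesLE (2 * n), (1 / p : ℝ) ≤ ∑ p ∈ Nat.primesLE n, (1 / p : ℝ) +
        ∑ p ∈ Nat.primesLE (2 * n) with n < p, (1 / p : ℝ) := by
      rw [← Finset.sum_filter_add_sum_filter_not (Nat.primesLE (2 * n)) (fun p ↦ n < p), add_comm]
      gcongr
      intro p hp
      simp only [Finset.mem_filter, Nat.mem_primesLE, not_lt] at hp ⊢
      exact ⟨hp.2, hp.1.2⟩
    have h2 : ∑ p ∈ Nat.primesLE (2 * n) with n < p, (1 / p : ℝ) ≤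
        ∑ p ∈ Nat.primesLE (2 * n), log p / (n * log n) := by
      refine (Finset.sum_le_sum fun p hp ↦ ?_).trans
        (Finset.sum_le_sum_of_subset_of_nonneg (Finset.filter_subset _ _) fun p _ _ ↦ ?_)
      · rw [Finset.mem_filter] at hp
        have hp' : (n : ℝ) < p := by exact_mod_cast hp.2
        have hpos : 0 < log n := by rw [hlogn]; positivity
        rw [div_le_div_iff₀ (hn0.trans hp') (by positivity), one_mul]
        have := log_le_log hn0 hp'.le
        nlinarith
      · have : 0 < log n := by rw [hlogn]; positivity
        positivity
    have h3 : ∑ p ∈ Nat.primesLE (2 * n), log p / (n * log n) ≤ 4 * ((J + 1 : ℕ) : ℝ)⁻¹ := by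
      rw [← Finset.sum_div, ← Chebyshev.theta_eq_sum_primesLE_log, hlogn]
      have h4 := Chebyshev.theta_le_log4_mul_x (x := ((2 * n : ℕ) : ℝ)) (by positivity)
      have h5 : log 4 = 2 * log 2 := by
        rw [show (4 : ℝ) = 2 ^ 2 by norm_num, log_pow]; norm_num
      rw [h5] at h4
      rw [div_le_iff₀ (by positivity)]
      refine h4.trans (le_of_eq ?_)
      push_cast
      field_simp
      ring
    rw [show 2 ^ (J + 1 + 1) = 2 * n by rw [hn]; ring, Finset.sum_Icc_succ_top (by omega)]
    linarith

theorem natLog_two_le (n : ℕ) : (Nat.log 2 n : ℝ) ≤ 2 * log n := by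
  rcases Nat.eq_zero_or_pos n with rfl | hn
  · simp
  have h1 : log ((2 : ℝ) ^ Nat.log 2 n) ≤ log n :=
    log_le_log (by positivity) (by exact_mod_cast Nat.pow_log_le_self 2 hn.ne')
  rw [log_pow] at h1
  have h2 := log_two_gt_d9
  have h3 : (0 : ℝ) ≤ Nat.log 2 n := by positivity
  nlinarith

/-- An upper bound of Mertens type. -/
theorem sum_primesLE_inv_le (n : ℕ) :
    ∑ p ∈ Nat.primesLE n, (1 / p : ℝ) ≤ 8 + 4 * log (1 + log n) := by
  have hlog : 0 ≤ log (n : ℝ) := log_natCast_nonneg n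
  have h1 := sum_primesLE_two_pow_inv_le (Nat.log 2 n)
  have h2 : ∑ p ∈ Nat.primesLE n, (1 / p : ℝ) ≤
      ∑ p ∈ Nat.primesLE (2 ^ (Nat.log 2 n + 1)), (1 / p : ℝ) := by
    refine Finset.sum_le_sum_of_subset_of_nonneg ?_ fun _ _ _ ↦ by positivity
    intro p hp
    rw [Nat.mem_primesLE] at hp ⊢
    exact ⟨hp.1.trans (Nat.lt_pow_succ_log_self one_lt_two n).le, hp.2⟩
  have h3 := harmonic_le_one_add_log (Nat.log 2 n)
  rw [harmonic_eq_sum_Icc] at h3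
  push_cast at h3
  have h4 : log (Nat.log 2 n) ≤ log 2 + log (1 + log n) := by
    rw [← log_mul two_ne_zero (by positivity)]
    rcases Nat.eq_zero_or_pos (Nat.log 2 n) with h | h
    · rw [h, Nat.cast_zero, log_zero]
      exact log_nonneg (by linarith)
    · refine log_le_log (by exact_mod_cast h) ?_
      linarith [natLog_two_le n]
  have h5 := log_two_lt_d9
  linarith

theorem card_primeFactors_le_log (n : ℕ) : n.primeFactors.card ≤ Nat.log 2 n := by
  rcases Nat.eq_zero_or_pos n with rfl | hn
  · simp
  refine Nat.le_log_of_pow_le one_lt_two ?_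
  calc 2 ^ n.primeFactors.card ≤ ∏ p ∈ n.primeFactors, p :=
        Finset.pow_card_le_prod _ _ _ fun p hp ↦ (Nat.prime_of_mem_primeFactors hp).two_le
    _ ≤ n := Nat.le_of_dvd hn (Nat.prod_primeFactors_dvd n)

theorem sum_primeFactors_inv_le (n : ℕ) :
    ∑ p ∈ n.primeFactors, (1 / p : ℝ) ≤ 13 + 4 * log (1 + log (1 + log n)) := by
  set r := Nat.log 2 n with hr
  have hlog : 0 ≤ log (n : ℝ) := log_natCast_nonneg n
  have hlog' : 0 ≤ log (1 + log (n : ℝ)) := log_nonneg (by linarith)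
  have h1 : ∑ p ∈ n.primeFactors, (1 / p : ℝ) ≤ ∑ p ∈ Nat.primesLE r, (1 / p : ℝ) + 1 := by
    rw [← Finset.sum_filter_add_sum_filter_not n.primeFactors (fun p ↦ p ≤ r)]
    gcongr
    · intro p hp
      simp only [Finset.mem_filter] at hp
      exact Nat.mem_primesLE.2 ⟨hp.2, Nat.prime_of_mem_primeFactors hp.1⟩
    · rcases Nat.eq_zero_or_pos r with h0 | h0
      · have := card_primeFactors_le_log n
        rw [← hr, h0, Nat.le_zero, Finset.card_eq_zero] at this
        simp [this]
      · have hr0 : (0 : ℝ) < r := by exact_mod_cast h0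
        calc ∑ p ∈ n.primeFactors with ¬ p ≤ r, (1 / p : ℝ)
            ≤ ∑ p ∈ n.primeFactors with ¬ p ≤ r, (1 / r : ℝ) := by
              refine Finset.sum_le_sum fun p hp ↦ ?_
              have := (Finset.mem_filter.1 hp).2
              gcongr
              omega
          _ ≤ r * (1 / r : ℝ) := by
              rw [Finset.sum_const, nsmul_eq_mul]
              gcongr
              exact (Finset.card_filter_le _ _).trans (card_primeFactors_le_log n)
          _ = 1 := by field_simp
  have h2 := sum_primesLE_inv_le r
  have h3 : log (1 + log r) ≤ 1 + log (1 + log (1 + log n)) := by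
    have h4 : log r ≤ 1 + log (1 + log n) := by
      rcases Nat.eq_zero_or_pos r with h0 | h0
      · rw [h0, Nat.cast_zero, log_zero]; linarith
      · calc log r ≤ log (2 * (1 + log n)) :=
              log_le_log (by exact_mod_cast h0) (by linarith [natLog_two_le n])
          _ = log 2 + log (1 + log n) := log_mul two_ne_zero (by positivity)
          _ ≤ 1 + log (1 + log n) := by linarith [log_two_lt_d9]
    calc log (1 + log r) ≤ log (2 * (1 + log (1 + log n))) :=
          log_le_log (by linarith [log_natCast_nonneg r]) (by linarith)
      _ = log 2 + log (1 + log (1 + log n)) := log_mul two_ne_zero (by positivity)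
      _ ≤ _ := by linarith [log_two_lt_d9]
  linarith

theorem hasSum_add_three_mul_half_pow : HasSum (fun k : ℕ ↦ (k + 3 : ℝ) * (1 / 2) ^ k) 8 := by
  have h1 := hasSum_coe_mul_geometric_of_norm_lt_one (r := (1 / 2 : ℝ)) (by norm_num)
  have h2 := (hasSum_geometric_of_lt_one (r := (1 / 2 : ℝ)) (by norm_num) (by norm_num)).mul_left 3
  have h3 : (1 / 2 / (1 - 1 / 2) ^ 2 + 3 * (1 - 1 / 2)⁻¹ : ℝ) = 8 := by norm_num
  simpa only [h3, add_mul] using h1.add h2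

theorem tsum_prime_pow_le {f : ℕ → ℝ} (h1 : f 1 = 1) (h0 : ∀ n, 0 ≤ f n) {p : ℕ} (hp : p.Prime)
    (hf : ∀ k : ℕ, f (p ^ k) ≤ (k + 1) / (p : ℝ) ^ k) :
    Summable (fun k ↦ f (p ^ k)) ∧ ∑' k, f (p ^ k) ≤ exp (f p + 8 / (p : ℝ) ^ 2) := by
  have hp2 : (2 : ℝ) ≤ p := by exact_mod_cast hp.two_le
  have hs := hasSum_add_three_mul_half_pow.mul_left (1 / (p : ℝ) ^ 2)
  have hle : ∀ k : ℕ, f (p ^ (k + 2)) ≤ 1 / (p : ℝ) ^ 2 * ((k + 3 : ℝ) * (1 / 2) ^ k) := by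
    intro k
    refine (hf (k + 2)).trans ?_
    have : (1 / (p : ℝ)) ^ k ≤ (1 / 2) ^ k := by gcongr
    calc (((k + 2 : ℕ) : ℝ) + 1) / (p : ℝ) ^ (k + 2)
        = 1 / (p : ℝ) ^ 2 * ((k + 3 : ℝ) * (1 / p) ^ k) := by
          push_cast
          rw [div_pow, one_pow]
          field_simp
          ring
      _ ≤ _ := by gcongr
  have hsum2 : Summable (fun k ↦ f (p ^ (k + 2))) :=
    Summable.of_nonneg_of_le (fun k ↦ h0 _) hle hs.summable
  have hsum : Summable (fun k ↦ f (p ^ k)) := (summable_nat_add_iff 2).1 hsum2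
  refine ⟨hsum, ?_⟩
  rw [← hsum.sum_add_tsum_nat_add 2]
  have := hsum2.tsum_le_tsum hle hs.summable
  rw [hs.tsum_eq] at this
  simp only [Finset.sum_range_succ, Finset.sum_range_zero, pow_zero, pow_one, h1]
  have h3 := add_one_le_exp (f p + 8 / (p : ℝ) ^ 2)
  have h4 : 1 / (p : ℝ) ^ 2 * 8 = 8 / (p : ℝ) ^ 2 := by ring
  linarith

open ArithmeticFunction in
theorem exists_sum_Ioc_le_exp_sum_primesLE : ∃ C : ℝ, ∀ f : ArithmeticFunction ℝ,
    f.IsMultiplicative → (∀ n, 0 ≤ f n) →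
    (∀ p k : ℕ, p.Prime → f (p ^ k) ≤ (k + 1) / (p : ℝ) ^ k) → ∀ z : ℕ,
    ∑ n ∈ Finset.Ioc 0 z, f n ≤ exp (∑ p ∈ Nat.primesLE z, f p + C) := by
  have hs : Summable fun n : ℕ ↦ 8 / (n : ℝ) ^ 2 := by
    simpa [div_eq_mul_inv] using (Real.summable_nat_pow_inv.2 one_lt_two).mul_left 8
  refine ⟨∑' n : ℕ, 8 / (n : ℝ) ^ 2, fun f hf h0 hpow z ↦ ?_⟩
  have key := EulerProduct.summable_and_hasSum_smoothNumbers_prod_primesBelow_tsum (f := f)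
    hf.map_one (fun {m n} h ↦ hf.map_mul_of_coprime h) (fun {p} hp ↦ by
      simpa [abs_of_nonneg (h0 _)] using (tsum_prime_pow_le hf.map_one h0 hp (hpow p · hp)).1) (z + 1)
  have key2 := hasSum_subtype_iff_indicator.1 key.2
  calc ∑ n ∈ Finset.Ioc 0 z, f n
      = ∑ n ∈ Finset.Ioc 0 z, (Nat.smoothNumbers (z + 1)).indicator f n := by
        refine Finset.sum_congr rfl fun n hn ↦ ?_
        rw [Finset.mem_Ioc] at hn
        rw [Set.indicator_of_mem (Nat.mem_smoothNumbers_of_lt hn.1 (by omega))]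
    _ ≤ ∏ p ∈ Nat.primesLE z, ∑' k, f (p ^ k) :=
        sum_le_hasSum _ (fun n _ ↦ Set.indicator_nonneg (fun n _ ↦ h0 n) n) key2
    _ ≤ ∏ p ∈ Nat.primesLE z, exp (f p + 8 / (p : ℝ) ^ 2) :=
        Finset.prod_le_prod (fun p _ ↦ tsum_nonneg fun k ↦ h0 _) fun p hp ↦
          (tsum_prime_pow_le hf.map_one h0 (Nat.prime_of_mem_primesLE hp)
            (hpow p · (Nat.prime_of_mem_primesLE hp))).2
    _ ≤ _ := by
        rw [← exp_sum, Finset.sum_add_distrib]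
        gcongr
        exact hs.sum_le_tsum _ fun n _ ↦ by positivity

/-- The arithmetic function `n ↦ 1 / n`. -/
noncomputable def invArith : ArithmeticFunction ℝ := ⟨fun n ↦ (n : ℝ)⁻¹, by simp⟩

/-- The arithmetic function `n ↦ χ₄(n) / n`. -/
noncomputable def chiInvArith : ArithmeticFunction ℝ :=
  ⟨fun n ↦ (ZMod.χ₄ n : ℝ) * (n : ℝ)⁻¹, by simp⟩

theorem invArith_apply (n : ℕ) : invArith n = (n : ℝ)⁻¹ := rfl

theorem chiInvArith_apply (n : ℕ) : chiInvArith n = (ZMod.χ₄ n : ℝ) * (n : ℝ)⁻¹ := rfl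

theorem isMultiplicative_invArith : invArith.IsMultiplicative :=
  ⟨by simp [invArith_apply], fun {m n} _ ↦ by simp [invArith_apply, mul_comm]⟩

theorem isMultiplicative_chiInvArith : chiInvArith.IsMultiplicative :=
  ⟨by simp [chiInvArith_apply], fun {m n} _ ↦ by
    simp only [chiInvArith_apply]
    push_cast
    rw [map_mul]
    push_cast
    ring⟩

theorem invArith_mul_chiInvArith_prime_pow {p : ℕ} (hp : p.Prime) (k : ℕ) :
    (invArith * chiInvArith) (p ^ k) =
      (∑ j ∈ Finset.range (k + 1), (ZMod.χ₄ p : ℝ) ^ j) / (p : ℝ) ^ k := by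
  have hp0 : (p : ℝ) ≠ 0 := by exact_mod_cast hp.ne_zero
  rw [mul_comm, ArithmeticFunction.mul_apply,
    Nat.sum_divisorsAntidiagonal (fun i j ↦ chiInvArith i * invArith j),
    Nat.sum_divisors_prime_pow hp, Finset.sum_div]
  refine Finset.sum_congr rfl fun j hj ↦ ?_
  have hjk : j ≤ k := by simpa [Nat.lt_succ_iff] using hj
  rw [Nat.pow_div hjk hp.pos, chiInvArith_apply, invArith_apply]
  push_cast
  rw [map_pow, mul_assoc, ← mul_inv, ← pow_add, Nat.add_sub_cancel' hjk]
  push_cast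
  rw [div_eq_mul_inv]

theorem invArith_mul_chiInvArith_nonneg (n : ℕ) : 0 ≤ (invArith * chiInvArith) n := by
  rcases eq_or_ne n 0 with rfl | hn
  · simp
  rw [(isMultiplicative_invArith.mul isMultiplicative_chiInvArith).multiplicative_factorization _ hn]
  refine Finset.prod_nonneg fun p hp ↦ ?_
  beta_reduce
  rw [invArith_mul_chiInvArith_prime_pow (Nat.prime_of_mem_primeFactors hp)]
  refine div_nonneg ?_ (by positivity)
  rcases ZMod.isQuadratic_χ₄ (p : ZMod 4) with h | h | h
  · rw [h]; exact Finset.sum_nonneg fun _ _ ↦ by simp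
  · rw [h]; exact Finset.sum_nonneg fun _ _ ↦ by simp
  · rw [h]
    push_cast
    rw [neg_one_geom_sum]
    split_ifs <;> norm_num

theorem sum_range_chi_mul_ge {F : ℕ → ℝ} (hF : AntitoneOn F (Set.Ici 1)) {M : ℕ} (hM : 0 < M) :
    F 1 - F 3 ≤ ∑ d ∈ Finset.range (4 * M), (ZMod.χ₄ d : ℝ) * F d := by
  have hstep (M : ℕ) : ∑ d ∈ Finset.range (4 * (M + 1)), (ZMod.χ₄ d : ℝ) * F d =
      ∑ d ∈ Finset.range (4 * M), (ZMod.χ₄ d : ℝ) * F d + (F (4 * M + 1) - F (4 * M + 3)) := by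
    have e0 : ZMod.χ₄ ((4 * M : ℕ) : ZMod 4) = 0 := by
      rw [ZMod.χ₄_nat_eq_if_mod_four, if_pos (by omega)]
    have e1 : ZMod.χ₄ ((4 * M + 1 : ℕ) : ZMod 4) = 1 := ZMod.χ₄_nat_one_mod_four (by omega)
    have e2 : ZMod.χ₄ ((4 * M + 2 : ℕ) : ZMod 4) = 0 := by
      rw [ZMod.χ₄_nat_eq_if_mod_four, if_pos (by omega)]
    have e3 : ZMod.χ₄ ((4 * M + 3 : ℕ) : ZMod 4) = -1 := ZMod.χ₄_nat_three_mod_four (by omega)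
    rw [show 4 * (M + 1) = 4 * M + 1 + 1 + 1 + 1 by ring]
    simp only [Finset.sum_range_succ, add_assoc, Nat.reduceAdd, e0, e1, e2, e3]
    push_cast
    ring
  induction M, hM using Nat.le_induction with
  | base =>
    rw [hstep 0]
    simp
  | succ M hM ih =>
    rw [hstep M]
    have := hF (a := 4 * M + 1) (b := 4 * M + 3) (by simp) (by simp) (by omega)
    linarith

theorem log_le_sum_invArith (z : ℕ) : log z ≤ ∑ n ∈ Finset.Ioc 0 z, invArith n := by
  rcases Nat.eq_zero_or_pos z with rfl | hz
  · simp
  have h := log_add_one_le_harmonic z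
  rw [harmonic_eq_sum_Icc] at h
  push_cast at h
  refine (log_le_log (by exact_mod_cast hz) (by linarith : (z : ℝ) ≤ z + 1)).trans (h.trans_eq ?_)
  rfl

theorem two_thirds_log_le_sum (z : ℕ) :
    2 / 3 * log z ≤ ∑ n ∈ Finset.Ioc 0 z, (invArith * chiInvArith) n := by
  set H : ℕ → ℝ := fun m ↦ ∑ n ∈ Finset.Ioc 0 m, invArith n with hH
  have hinv (n : ℕ) : 0 ≤ invArith n := by rw [invArith_apply]; positivity
  have hHmono : Monotone H := fun a b hab ↦
    Finset.sum_le_sum_of_subset_of_nonneg (Finset.Ioc_subset_Ioc_right hab) fun n _ _ ↦ hinv n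
  have hH0 (m : ℕ) : 0 ≤ H m := Finset.sum_nonneg fun n _ ↦ hinv n
  set F : ℕ → ℝ := fun d ↦ (d : ℝ)⁻¹ * H (z / d) with hF
  have hanti : AntitoneOn F (Set.Ici 1) := by
    intro a ha b hb hab
    have ha' : (0 : ℝ) < a := by exact_mod_cast (Set.mem_Ici.1 ha)
    simp only [hF]
    gcongr
    · exact hH0 _
    · exact hHmono (Nat.div_le_div_left hab ha)
  have h1 := sum_range_chi_mul_ge hanti (M := z + 1) (by omega)
  rw [mul_comm invArith, ArithmeticFunction.sum_Ioc_mul_eq_sum_sum]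
  have h2 : ∑ d ∈ Finset.range (4 * (z + 1)), (ZMod.χ₄ d : ℝ) * F d =
      ∑ n ∈ Finset.Ioc 0 z, chiInvArith n * ∑ m ∈ Finset.Ioc 0 (z / n), invArith m := by
    symm
    have h3 : ∀ n, chiInvArith n * ∑ m ∈ Finset.Ioc 0 (z / n), invArith m =
        (ZMod.χ₄ n : ℝ) * F n := fun n ↦ by rw [chiInvArith_apply, mul_assoc]
    simp only [h3]
    refine Finset.sum_subset ?_ fun d hd hd' ↦ ?_
    · intro d hd
      simp only [Finset.mem_Ioc, Finset.mem_range] at hd ⊢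
      omega
    · rw [Finset.mem_Ioc] at hd'
      rcases Nat.eq_zero_or_pos d with rfl | h0
      · simp
      · have : z / d = 0 := Nat.div_eq_of_lt (by omega)
        simp [hF, hH, this]
  rw [h2] at h1
  have h3 : F 1 = H z := by simp [hF]
  have h4 : F 3 ≤ 1 / 3 * H z := by
    simp only [hF]
    have := hHmono (Nat.div_le_self z 3)
    push_cast
    linarith
  have h5 : log z ≤ H z := log_le_sum_invArith z
  linarith

theorem invArith_mul_chiInvArith_prime {p : ℕ} (hp : p.Prime) :
    (invArith * chiInvArith) p = (1 + (ZMod.χ₄ p : ℝ)) / p := by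
  have := invArith_mul_chiInvArith_prime_pow hp 1
  simpa [Finset.sum_range_succ] using this

/-- A lower bound of Mertens type for `2 + χ₄`. -/
theorem exists_le_sum_primesLE_chi : ∃ C : ℝ, ∀ z : ℕ, 2 ≤ z →
    2 * log (log z) - C ≤ ∑ p ∈ Nat.primesLE z, (2 + (ZMod.χ₄ p : ℝ)) / p := by
  obtain ⟨C, hC⟩ := exists_sum_Ioc_le_exp_sum_primesLE
  refine ⟨2 * C - log (2 / 3), fun z hz ↦ ?_⟩
  have hlog : 0 < log (z : ℝ) := log_pos (by exact_mod_cast hz)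
  have h1 := (log_le_sum_invArith z).trans <| hC invArith isMultiplicative_invArith
    (fun n ↦ by rw [invArith_apply]; positivity) (fun p k hp ↦ by
      rw [invArith_apply]
      push_cast
      rw [inv_eq_one_div]
      gcongr
      linarith [(Nat.cast_nonneg k : (0 : ℝ) ≤ k)]) z
  have h2 := (two_thirds_log_le_sum z).trans <| hC (invArith * chiInvArith)
    (isMultiplicative_invArith.mul isMultiplicative_chiInvArith) invArith_mul_chiInvArith_nonneg
    (fun p k hp ↦ by
      rw [invArith_mul_chiInvArith_prime_pow hp]
      gcongr
      calc ∑ j ∈ Finset.range (k + 1), (ZMod.χ₄ p : ℝ) ^ j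
          ≤ ∑ j ∈ Finset.range (k + 1), (1 : ℝ) := by
            refine Finset.sum_le_sum fun j _ ↦ (le_abs_self _).trans ?_
            rw [abs_pow]
            refine pow_le_one₀ (abs_nonneg _) ?_
            rcases ZMod.isQuadratic_χ₄ (p : ZMod 4) with h | h | h <;> rw [h] <;> norm_num
        _ = k + 1 := by simp) z
  have h3 := log_le_log hlog h1
  have h4 := log_le_log (by positivity) h2
  rw [log_exp] at h3 h4
  rw [log_mul (by norm_num) hlog.ne'] at h4
  have h5 : ∑ p ∈ Nat.primesLE z, (2 + (ZMod.χ₄ p : ℝ)) / p =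
      ∑ p ∈ Nat.primesLE z, invArith p + ∑ p ∈ Nat.primesLE z, (invArith * chiInvArith) p := by
    rw [← Finset.sum_add_distrib]
    refine Finset.sum_congr rfl fun p hp ↦ ?_
    rw [invArith_mul_chiInvArith_prime (Nat.prime_of_mem_primesLE hp), invArith_apply]
    ring
  linarith

theorem exists_finset_roots {l m b : ℕ} (hl : l.Prime) (h2 : l ≠ 2) (hm : ¬ l ∣ m) (hb : ¬ l ∣ b) :
    ∃ A : Finset (ZMod l), (A.card : ℤ) = 2 + ZMod.χ₄ l ∧
      ∀ n : ℕ, (n : ZMod l) ∈ A → l ∣ n ∨ l ∣ (m * n) ^ 2 + b ^ 2 := by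
  have : Fact l.Prime := ⟨hl⟩
  have hodd : l % 2 = 1 := hl.eq_two_or_odd.resolve_left h2
  have hm0 : (m : ZMod l) ≠ 0 := by rwa [Ne, ZMod.natCast_eq_zero_iff]
  have hb0 : (b : ZMod l) ≠ 0 := by rwa [Ne, ZMod.natCast_eq_zero_iff]
  by_cases h4 : l % 4 = 3
  · refine ⟨{0}, ?_, fun n hn ↦ Or.inl ?_⟩
    · rw [ZMod.χ₄_nat_three_mod_four h4]
      simp
    · rwa [Finset.mem_singleton, ZMod.natCast_eq_zero_iff] at hn
  · obtain ⟨i, hi⟩ := ZMod.exists_sq_eq_neg_one_iff.2 h4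
    have hi0 : i ≠ 0 := by
      rintro rfl
      simp at hi
    set x : ZMod l := b * i / m with hx
    have hx0 : x ≠ 0 := div_ne_zero (mul_ne_zero hb0 hi0) hm0
    have hxx : m * x = b * i := by rw [hx]; field_simp
    have hneg : x ≠ -x := by
      have : ringChar (ZMod l) ≠ 2 := by rwa [ZMod.ringChar_zmod_n]
      exact fun h ↦ hx0 ((Ring.eq_self_iff_eq_zero_of_char_ne_two this).1 h.symm)
    refine ⟨{0, x, -x}, ?_, fun n hn ↦ ?_⟩
    · rw [ZMod.χ₄_nat_one_mod_four (by omega),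
        Finset.card_eq_three.2 ⟨0, x, -x, hx0.symm, (neg_ne_zero.2 hx0).symm, hneg, rfl⟩]
      norm_num
    · simp only [Finset.mem_insert, Finset.mem_singleton] at hn
      rw [← ZMod.natCast_eq_zero_iff, ← ZMod.natCast_eq_zero_iff]
      rcases hn with hn | hn
      · exact Or.inl hn
      · refine Or.inr ?_
        push_cast
        have : (m * n : ZMod l) ^ 2 = (b * i) ^ 2 := by
          rcases hn with hn | hn <;> rw [hn, ← hxx]
          ring
        rw [this, mul_pow, sq i, ← hi]
        ring

theorem card_filter_prime_prime_le {m b z : ℕ} (hm : 0 < m) (hb : 0 < b) (hz : 0 < z) (X k : ℕ) :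
    (((Finset.range X).filter
        fun p : ℕ ↦ p.Prime ∧ z < p ∧ ((m * p) ^ 2 + b ^ 2).Prime).card : ℝ) ≤
      X * (exp (3 * ∑ p ∈ (2 * (m * b)).primeFactors, (1 / p : ℝ) -
          ∑ p ∈ Nat.primesLE z, (2 + (ZMod.χ₄ p : ℝ)) / p) +
        exp (9 * ∑ p ∈ Nat.primesLE z, (1 / p : ℝ) - 2 * k)) + exp 3 * (z : ℝ) ^ (2 * k) := by
  have hΩ : ∀ l : ℕ, ∃ A : Finset (ZMod l), l.Prime → ¬ l ∣ 2 * (m * b) →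
      (A.card : ℤ) = 2 + ZMod.χ₄ l ∧
        ∀ n : ℕ, (n : ZMod l) ∈ A → l ∣ n ∨ l ∣ (m * n) ^ 2 + b ^ 2 := by
    intro l
    by_cases hl : l.Prime ∧ ¬ l ∣ 2 * (m * b)
    · obtain ⟨A, hA⟩ := exists_finset_roots (m := m) (b := b) hl.1
        (by rintro rfl; exact hl.2 (dvd_mul_right _ _))
        (fun h ↦ hl.2 ((h.mul_right b).mul_left 2)) (fun h ↦ hl.2 ((h.mul_left m).mul_left 2))
      exact ⟨A, fun _ _ ↦ hA⟩
    · exact ⟨∅, fun h1 h2 ↦ absurd ⟨h1, h2⟩ hl⟩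
  choose Ω hΩ using hΩ
  set Q := (Nat.primesLE z).filter fun l ↦ ¬ l ∣ 2 * (m * b) with hQ
  have hQ' : ∀ l ∈ Q, l.Prime ∧ l ≤ z ∧ ¬ l ∣ 2 * (m * b) := fun l hl ↦ by
    rw [hQ, Finset.mem_filter, Nat.mem_primesLE] at hl
    exact ⟨hl.1.2, hl.1.1, hl.2⟩
  have hcard : ∀ l ∈ Q, ((Ω l).card : ℝ) = 2 + (ZMod.χ₄ l : ℝ) := fun l hl ↦ by
    exact_mod_cast (hΩ l (hQ' l hl).1 (hQ' l hl).2.2).1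
  have hchi (l : ℕ) : (ZMod.χ₄ l : ℝ) ≤ 1 := by
    rcases ZMod.isQuadratic_χ₄ (l : ZMod 4) with h | h | h <;> rw [h] <;> norm_num
  have hcard3 : ∀ l ∈ Q, ((Ω l).card : ℝ) ≤ 3 := fun l hl ↦ by
    linarith [hcard l hl, hchi l]
  have hsieve := count_forall_notMem_zmod_le Ω Q (fun l hl ↦ (hQ' l hl).1) hz
    (by
      have : Q ⊆ Finset.Ioc 0 z := fun l hl ↦
        Finset.mem_Ioc.2 ⟨(hQ' l hl).1.pos, (hQ' l hl).2.1⟩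
      simpa using Finset.card_le_card this)
    (fun l hl ↦ by exact_mod_cast hcard3 l hl)
    (fun l hl ↦ by
      have : Fact l.Prime := ⟨(hQ' l hl).1⟩
      simpa [ZMod.card] using Finset.card_le_univ (Ω l)) X k
  have hle : ((Finset.range X).filter
        fun p : ℕ ↦ p.Prime ∧ z < p ∧ ((m * p) ^ 2 + b ^ 2).Prime).card ≤
      Nat.count (fun n : ℕ ↦ ∀ l ∈ Q, (n : ZMod l) ∉ Ω l) X := by
    rw [Nat.count_eq_card_filter_range]
    refine Finset.card_le_card fun p hp ↦ ?_
    simp only [Finset.mem_filter] at hp ⊢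
    refine ⟨hp.1, fun l hl hmem ↦ ?_⟩
    obtain ⟨hlp, hlz, hldvd⟩ := hQ' l hl
    obtain ⟨-, hpp, hzp, hprime⟩ := hp
    rcases (hΩ l hlp hldvd).2 p hmem with h | h
    · rw [Nat.prime_dvd_prime_iff_eq hlp hpp] at h
      omega
    · rw [Nat.prime_dvd_prime_iff_eq hlp hprime] at h
      have h1 : p ≤ (m * p) ^ 2 := by nlinarith [Nat.mul_le_mul hm (le_refl p), hpp.pos]
      omega
  have hG : ∑ p ∈ Nat.primesLE z, (2 + (ZMod.χ₄ p : ℝ)) / p -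
      3 * ∑ p ∈ (2 * (m * b)).primeFactors, (1 / p : ℝ) ≤ ∑ l ∈ Q, ((Ω l).card / l : ℝ) := by
    rw [← Finset.sum_filter_add_sum_filter_not (Nat.primesLE z) (fun l ↦ ¬ l ∣ 2 * (m * b)),
      ← hQ, Finset.mul_sum]
    have h1 : ∑ l ∈ Q, (2 + (ZMod.χ₄ l : ℝ)) / l = ∑ l ∈ Q, ((Ω l).card / l : ℝ) :=
      Finset.sum_congr rfl fun l hl ↦ by rw [hcard l hl]
    have h2 : ∑ l ∈ Nat.primesLE z with ¬ ¬ l ∣ 2 * (m * b), (2 + (ZMod.χ₄ l : ℝ)) / l ≤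
        ∑ p ∈ (2 * (m * b)).primeFactors, 3 * (1 / p : ℝ) := by
      refine (Finset.sum_le_sum fun l hl ↦ ?_).trans
        (Finset.sum_le_sum_of_subset_of_nonneg (fun l hl ↦ ?_) fun p _ _ ↦ by positivity)
      · rw [mul_one_div]
        gcongr
        linarith [hchi l]
      · rw [Finset.mem_filter, not_not, Nat.mem_primesLE] at hl
        exact Nat.mem_primeFactors.2 ⟨hl.1.2, hl.2, by positivity⟩
    linarith
  have hG' : ∑ l ∈ Q, ((Ω l).card / l : ℝ) ≤ 3 * ∑ p ∈ Nat.primesLE z, (1 / p : ℝ) := by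
    rw [Finset.mul_sum]
    refine (Finset.sum_le_sum fun l hl ↦ ?_).trans
      (Finset.sum_le_sum_of_subset_of_nonneg (Finset.filter_subset _ _) fun p _ _ ↦ by positivity)
    rw [mul_one_div]
    gcongr
    exact hcard3 l hl
  have h1 := exp_le_exp.2 (by linarith :
    -∑ l ∈ Q, ((Ω l).card / l : ℝ) ≤ 3 * ∑ p ∈ (2 * (m * b)).primeFactors, (1 / p : ℝ) -
      ∑ p ∈ Nat.primesLE z, (2 + (ZMod.χ₄ p : ℝ)) / p)
  have h2 := exp_le_exp.2 (by linarith : 3 * ∑ l ∈ Q, ((Ω l).card / l : ℝ) - 2 * k ≤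
    9 * ∑ p ∈ Nat.primesLE z, (1 / p : ℝ) - 2 * k)
  exact (Nat.cast_le.2 hle).trans (hsieve.trans
    (add_le_add_left (mul_le_mul_of_nonneg_left (add_le_add h1 h2) X.cast_nonneg) _))

/-- The sieve bound with the sieving range and the truncation chosen in terms of `log N`. -/
theorem exists_card_filter_prime_prime_le : ∃ C : ℝ, 0 < C ∧ ∀ N : ℝ, 0 < N →
    1 ≤ log (log N) → 525 * log (log N) ^ 2 ≤ log N → ∀ m b X : ℕ, 0 < m → 0 < b →
    (m * b : ℝ) ≤ N → exp (log N / log (log N)) ≤ X →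
    (((Finset.range X).filter fun p : ℕ ↦ p.Prime ∧ exp (log N / log (log N)) < p ∧
        ((m * p) ^ 2 + b ^ 2).Prime).card : ℝ) ≤ C * X * log (log N) ^ 16 / log N ^ 2 := by
  obtain ⟨C, hC⟩ := exists_le_sum_primesLE_chi
  refine ⟨exp (39 + C) * 100 ^ 2 * 3 ^ 12 + exp 108 + 1, by positivity, ?_⟩
  intro N hN hu1 huL m b X hm hb hmb hX
  set L := log N with hLdef
  set u := log L with hudef
  have hu0 : 0 < u := by linarith
  have hL525 : 525 ≤ L := by nlinarith
  have hL0 : 0 < L := by linarith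
  have hexpu : exp u = L := exp_log hL0
  have hmb0 : (0 : ℝ) < m * b := by positivity
  have hX0 : (0 : ℝ) < X := (exp_pos _).trans_le hX
  set t := exp (L / (84 * u ^ 2)) with ht
  set z := ⌊t⌋₊ with hzdef
  have h525 : 525 ≤ L / u ^ 2 := by rwa [le_div_iff₀ (by positivity)]
  have hLu : L / (84 * u ^ 2) = L / u ^ 2 / 84 := by rw [mul_comm, div_div]
  have ht2 : 2 ≤ t := by
    have := add_one_le_exp (L / (84 * u ^ 2))
    rw [hLu] at this
    rw [ht, hLu]
    linarith
  have hz2 : 2 ≤ z := Nat.le_floor (by exact_mod_cast ht2)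
  have hz0 : (0 : ℝ) < z := by exact_mod_cast (by omega : 0 < z)
  have hzt : (z : ℝ) ≤ t := Nat.floor_le (by positivity)
  have htz : t / 2 ≤ z := by
    have := Nat.lt_floor_add_one t
    linarith
  have hlogz : L / (100 * u ^ 2) ≤ log z := by
    have h1 : log (t / 2) ≤ log z := log_le_log (by positivity) htz
    rw [log_div (by positivity) two_ne_zero, ht, log_exp, hLu] at h1
    have h2 : L / (100 * u ^ 2) = L / u ^ 2 / 100 := by rw [mul_comm, div_div]
    rw [h2]
    linarith [log_two_lt_d9]
  have hlogz0 : 0 < log z := lt_of_lt_of_le (by positivity) hlogz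
  have hlogzL : log z ≤ L := by
    have h1 : log z ≤ log t := log_le_log hz0 hzt
    rw [ht, log_exp] at h1
    refine h1.trans (div_le_self hL0.le ?_)
    nlinarith
  set k := ⌈20 * u⌉₊ with hk
  have hk1 : 20 * u ≤ k := Nat.le_ceil _
  have hk2 : (k : ℝ) ≤ 21 * u := by
    have := (Nat.ceil_lt_add_one (by positivity : 0 ≤ 20 * u)).le
    linarith
  have hmain := card_filter_prime_prime_le hm hb (by omega : 0 < z) X k
  have hzy : (z : ℝ) ≤ exp (L / u) := by
    refine hzt.trans (exp_le_exp.2 ?_)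
    gcongr
    nlinarith
  have hsub : (((Finset.range X).filter fun p : ℕ ↦ p.Prime ∧ exp (L / u) < p ∧
        ((m * p) ^ 2 + b ^ 2).Prime).card : ℝ) ≤ (((Finset.range X).filter
        fun p : ℕ ↦ p.Prime ∧ z < p ∧ ((m * p) ^ 2 + b ^ 2).Prime).card : ℝ) := by
    refine Nat.cast_le.2 (Finset.card_le_card fun p hp ↦ ?_)
    simp only [Finset.mem_filter] at hp ⊢
    exact ⟨hp.1, hp.2.1, by exact_mod_cast hzy.trans_lt hp.2.2.1, hp.2.2.2⟩
  have hu16 : 1 ≤ u ^ 16 := one_le_pow₀ hu1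
  have hterm1 : exp (3 * ∑ p ∈ (2 * (m * b)).primeFactors, (1 / p : ℝ) -
      ∑ p ∈ Nat.primesLE z, (2 + (ZMod.χ₄ p : ℝ)) / p) ≤
      exp (39 + C) * 100 ^ 2 * 3 ^ 12 * u ^ 16 / L ^ 2 := by
    have h1 := hC z hz2
    have h2 := sum_primeFactors_inv_le (2 * (m * b))
    have h3 : log ((2 * (m * b) : ℕ) : ℝ) ≤ 1 + L := by
      push_cast
      rw [log_mul two_ne_zero hmb0.ne']
      have := log_le_log hmb0 hmb
      linarith [log_two_lt_d9]
    have h3' : 0 ≤ log ((2 * (m * b) : ℕ) : ℝ) := log_natCast_nonneg _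
    have h4 : log (1 + log ((2 * (m * b) : ℕ) : ℝ)) ≤ 1 + u := by
      calc log (1 + log ((2 * (m * b) : ℕ) : ℝ)) ≤ log (2 * L) :=
            log_le_log (by linarith) (by linarith)
        _ = log 2 + u := log_mul two_ne_zero hL0.ne'
        _ ≤ 1 + u := by linarith [log_two_lt_d9]
    have h4' : 0 ≤ log (1 + log ((2 * (m * b) : ℕ) : ℝ)) := log_nonneg (by linarith)
    have h5 : log (1 + log (1 + log ((2 * (m * b) : ℕ) : ℝ))) ≤ log (3 * u) :=
      log_le_log (by linarith) (by linarith)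
    have h6 : log (L / (100 * u ^ 2)) ≤ log (log z) := log_le_log (by positivity) hlogz
    calc _ ≤ exp ((39 + C) + (12 : ℕ) * log (3 * u) - (2 : ℕ) * log (L / (100 * u ^ 2))) := by
          apply exp_le_exp.2
          push_cast
          linarith
      _ = exp (39 + C) * (3 * u) ^ 12 / (L / (100 * u ^ 2)) ^ 2 := by
          rw [exp_sub, exp_add, exp_nat_mul, exp_nat_mul, exp_log (by positivity),
            exp_log (by positivity)]
      _ = _ := by
          field_simp
  have hterm2 : exp (9 * ∑ p ∈ Nat.primesLE z, (1 / p : ℝ) - 2 * k) ≤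
      exp 108 * u ^ 16 / L ^ 2 := by
    have h1 := sum_primesLE_inv_le z
    have h2 : log (1 + log z) ≤ 1 + u := by
      calc log (1 + log z) ≤ log (2 * L) := log_le_log (by linarith) (by linarith)
        _ = log 2 + u := log_mul two_ne_zero hL0.ne'
        _ ≤ 1 + u := by linarith [log_two_lt_d9]
    calc _ ≤ exp (108 - (2 : ℕ) * u) := by
          apply exp_le_exp.2
          push_cast
          linarith
      _ = exp 108 / L ^ 2 := by rw [exp_sub, exp_nat_mul, hexpu]
      _ ≤ _ := by
          gcongr
          exact le_mul_of_one_le_right (exp_pos _).le hu16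
  have hterm3 : exp 3 * (z : ℝ) ^ (2 * k) ≤ X * (1 * u ^ 16 / L ^ 2) := by
    calc exp 3 * (z : ℝ) ^ (2 * k) ≤ exp 3 * t ^ (2 * k) := by gcongr
      _ = exp (3 + (2 * k : ℕ) * (L / (84 * u ^ 2))) := by rw [ht, ← exp_nat_mul, ← exp_add]
      _ ≤ exp (L / u - (2 : ℕ) * u) := by
          apply exp_le_exp.2
          push_cast
          have h1 : 2 * k * (L / (84 * u ^ 2)) ≤ 2 * (21 * u) * (L / (84 * u ^ 2)) := by gcongr
          have h2 : 2 * (21 * u) * (L / (84 * u ^ 2)) = L / u / 2 := by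
            field_simp
            norm_num
          have h3 : 525 * u ≤ L / u := by
            rw [le_div_iff₀ hu0]
            linarith
          linarith
      _ = exp (L / u) * (1 * 1 / L ^ 2) := by rw [exp_sub, exp_nat_mul, hexpu]; ring
      _ ≤ X * (1 * u ^ 16 / L ^ 2) := by gcongr
  calc _ ≤ _ := hsub.trans hmain
    _ ≤ X * (exp (39 + C) * 100 ^ 2 * 3 ^ 12 * u ^ 16 / L ^ 2 + exp 108 * u ^ 16 / L ^ 2) +
        X * (1 * u ^ 16 / L ^ 2) := by gcongr
    _ = _ := by ring

theorem prime_maxPrimeFac_and_dvd {n : ℕ} (hn : 1 < n) :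
    (maxPrimeFac n).Prime ∧ maxPrimeFac n ∣ n := by
  have hne : n.primeFactors.Nonempty := Nat.nonempty_primeFactors.2 hn
  obtain ⟨p, hp, hsup⟩ := Finset.exists_mem_eq_sup _ hne id
  rw [maxPrimeFac, if_neg (by omega), hsup]
  exact ⟨Nat.prime_of_mem_primeFactors hp, Nat.dvd_of_mem_primeFactors hp⟩

theorem sum_Icc_inv_le (M : ℕ) : ∑ m ∈ Finset.Icc 1 M, (m : ℝ)⁻¹ ≤ 1 + log M := by
  have h := harmonic_le_one_add_log M
  rw [harmonic_eq_sum_Icc] at h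
  push_cast at h
  exact h

theorem ncard_pairs_le (N y B : ℝ) (hB : 0 ≤ B) (hN : 1 ≤ N)
    (h : ∀ m b X : ℕ, 0 < m → 0 < b → (m * b : ℝ) ≤ N → y ≤ X →
      (((Finset.range X).filter fun p : ℕ ↦ p.Prime ∧ y < p ∧ ((m * p) ^ 2 + b ^ 2).Prime).card : ℝ)
        ≤ B * X) :
    ({p : ℕ × ℕ | 0 < p.1 ∧ 0 < p.2 ∧ 1 < p.1 * p.2 ∧
        ((p.1 * p.2 : ℕ) : ℝ) ≤ N ∧ Nat.Prime (p.1 ^ 2 + p.2 ^ 2) ∧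
        y < (maxPrimeFac (p.1 * p.2) : ℝ)}.ncard : ℝ) ≤ 4 * B * N * (1 + log N) ^ 2 := by
  classical
  set M := ⌊N⌋₊ with hM
  have hMN : (M : ℝ) ≤ N := Nat.floor_le (by linarith)
  have hM1 : 1 ≤ M := Nat.le_floor (by exact_mod_cast hN)
  set T : ℕ → ℕ → Finset ℕ := fun m b ↦ (Finset.range (M / (m * b) + 1)).filter
    fun p : ℕ ↦ p.Prime ∧ y < p ∧ ((m * p) ^ 2 + b ^ 2).Prime with hT
  set U : Finset (ℕ × ℕ) := (Finset.Icc 1 M ×ˢ Finset.Icc 1 M).biUnion fun q ↦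
    (T q.1 q.2).image (fun p ↦ (q.1 * p, q.2)) ∪ (T q.1 q.2).image (fun p ↦ (q.2, q.1 * p)) with hU
  have hTcard : ∀ m ∈ Finset.Icc 1 M, ∀ b ∈ Finset.Icc 1 M,
      ((T m b).card : ℝ) ≤ 2 * B * N * ((m : ℝ)⁻¹ * (b : ℝ)⁻¹) := by
    intro m hm b hb
    rw [Finset.mem_Icc] at hm hb
    have hm0 : (0 : ℝ) < m := by exact_mod_cast hm.1
    have hb0 : (0 : ℝ) < b := by exact_mod_cast hb.1
    rcases Finset.eq_empty_or_nonempty (T m b) with he | ⟨p, hp⟩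
    · rw [he, Finset.card_empty, Nat.cast_zero]
      positivity
    · simp only [hT, Finset.mem_filter, Finset.mem_range, Nat.lt_succ_iff] at hp
      obtain ⟨hpX, hpp, hyp, -⟩ := hp
      have hmbM : m * b ≤ M := by
        by_contra! hlt
        rw [Nat.div_eq_of_lt hlt] at hpX
        exact hpp.pos.ne' (Nat.le_zero.1 hpX)
      have hmbN : (m * b : ℝ) ≤ N := le_trans (by exact_mod_cast hmbM) hMN
      have hyX : y ≤ ((M / (m * b) + 1 : ℕ) : ℝ) :=
        hyp.le.trans (Nat.cast_le.2 (hpX.trans (Nat.le_succ _)))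
      refine (h m b _ hm.1 hb.1 hmbN hyX).trans ?_
      have h1 : ((M / (m * b) + 1 : ℕ) : ℝ) ≤ 2 * N * ((m : ℝ)⁻¹ * (b : ℝ)⁻¹) := by
        have h2 : ((M / (m * b) : ℕ) : ℝ) ≤ M / (m * b : ℕ) := Nat.cast_div_le
        push_cast at h2 ⊢
        have h3 : (M : ℝ) / (m * b) ≤ N / (m * b) := by gcongr
        have h4 : 1 ≤ N / (m * b) := (one_le_div (by positivity)).2 hmbN
        have h5 : 2 * N * ((m : ℝ)⁻¹ * (b : ℝ)⁻¹) = 2 * (N / (m * b)) := by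
          rw [← mul_inv]; ring
        linarith
      have := mul_le_mul_of_nonneg_left h1 hB
      linarith
  have hsubset : {p : ℕ × ℕ | 0 < p.1 ∧ 0 < p.2 ∧ 1 < p.1 * p.2 ∧
      ((p.1 * p.2 : ℕ) : ℝ) ≤ N ∧ Nat.Prime (p.1 ^ 2 + p.2 ^ 2) ∧
      y < (maxPrimeFac (p.1 * p.2) : ℝ)} ⊆ (U : Set (ℕ × ℕ)) := by
    rintro ⟨a, b⟩ ⟨ha, hb, hab, habN, hprime, hy⟩
    dsimp only at ha hb hab habN hprime hy
    obtain ⟨hp, hpdvd⟩ := prime_maxPrimeFac_and_dvd hab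
    set p := maxPrimeFac (a * b) with hpdef
    have habM : a * b ≤ M := Nat.le_floor habN
    have hmem : ∀ m c : ℕ, 0 < m → 0 < c → p * m * c ≤ M → ((m * p) ^ 2 + c ^ 2).Prime →
        (m, c) ∈ Finset.Icc 1 M ×ˢ Finset.Icc 1 M ∧ p ∈ T m c := by
      intro m c hm hc hmc hpr
      refine ⟨Finset.mem_product.2 ⟨Finset.mem_Icc.2 ⟨hm, ?_⟩, Finset.mem_Icc.2 ⟨hc, ?_⟩⟩,
        Finset.mem_filter.2 ⟨Finset.mem_range.2 (Nat.lt_succ_iff.2 ?_), hp, hy, hpr⟩⟩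
      · exact (Nat.le_mul_of_pos_left m (Nat.mul_pos hp.pos hc)).trans (by linarith)
      · exact (Nat.le_mul_of_pos_left c (Nat.mul_pos hp.pos hm)).trans hmc
      · rw [Nat.le_div_iff_mul_le (Nat.mul_pos hm hc)]
        linarith
    rw [Finset.mem_coe, hU, Finset.mem_biUnion]
    rcases hp.dvd_mul.1 hpdvd with ⟨m, hm⟩ | ⟨m, hm⟩
    · have hm0 : 0 < m := Nat.pos_of_ne_zero (by rintro rfl; omega)
      have := hmem m b hm0 hb (by rwa [← hm]) (by rwa [mul_comm m, ← hm])
      refine ⟨(m, b), this.1, Finset.mem_union_left _ (Finset.mem_image.2 ⟨p, this.2, ?_⟩)⟩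
      rw [hm, mul_comm p]
    · have hm0 : 0 < m := Nat.pos_of_ne_zero (by rintro rfl; omega)
      have := hmem m a hm0 ha (by rwa [← hm, mul_comm]) (by rwa [mul_comm m, ← hm, add_comm])
      refine ⟨(m, a), this.1, Finset.mem_union_right _ (Finset.mem_image.2 ⟨p, this.2, ?_⟩)⟩
      rw [hm, mul_comm p]
  have hUcard : U.card ≤ ∑ q ∈ Finset.Icc 1 M ×ˢ Finset.Icc 1 M, 2 * (T q.1 q.2).card := by
    refine Finset.card_biUnion_le.trans (Finset.sum_le_sum fun q _ ↦ ?_)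
    refine (Finset.card_union_le _ _).trans ?_
    rw [two_mul]
    exact add_le_add Finset.card_image_le Finset.card_image_le
  have hncard := (Set.ncard_le_ncard hsubset U.finite_toSet).trans_eq (Set.ncard_coe_finset U)
  calc _ ≤ ((∑ q ∈ Finset.Icc 1 M ×ˢ Finset.Icc 1 M, 2 * (T q.1 q.2).card : ℕ) : ℝ) :=
        Nat.cast_le.2 (hncard.trans hUcard)
    _ ≤ ∑ q ∈ Finset.Icc 1 M ×ˢ Finset.Icc 1 M,
          4 * B * N * ((q.1 : ℝ)⁻¹ * (q.2 : ℝ)⁻¹) := by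
        push_cast
        refine Finset.sum_le_sum fun q hq ↦ ?_
        rw [Finset.mem_product] at hq
        linarith [hTcard q.1 hq.1 q.2 hq.2]
    _ = 4 * B * N * (∑ m ∈ Finset.Icc 1 M, (m : ℝ)⁻¹) ^ 2 := by
        rw [← Finset.mul_sum, sq, Finset.sum_mul_sum, Finset.sum_product]
    _ ≤ 4 * B * N * (1 + log N) ^ 2 := by
        have h1 := sum_Icc_inv_le M
        have h2 : log M ≤ log N := log_le_log (by exact_mod_cast hM1) hMN
        gcongr
        linarith

theorem stmt_19 :
    ∃ C K : ℝ, 0 < C ∧ 0 ≤ K ∧ ∃ N₀ : ℝ, ∀ N : ℝ, N₀ ≤ N →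
      ({p : ℕ × ℕ | 0 < p.1 ∧ 0 < p.2 ∧ 1 < p.1 * p.2 ∧
          ((p.1 * p.2 : ℕ) : ℝ) ≤ N ∧ Nat.Prime (p.1 ^ 2 + p.2 ^ 2) ∧
          N ^ (1 / Real.log (Real.log N)) < (maxPrimeFac (p.1 * p.2) : ℝ)}.ncard : ℝ)
        ≤ C * N * Real.log (Real.log N) ^ K := by
  obtain ⟨C, hC0, hC⟩ := exists_card_filter_prime_prime_le
  have hev : ∀ᶠ N : ℝ in Filter.atTop,
      1 ≤ N ∧ 1 ≤ log (log N) ∧ 525 * log (log N) ^ 2 ≤ log N := by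
    have h1 : ∀ᶠ x : ℝ in Filter.atTop, 525 * log x ^ 2 ≤ x := by
      have := (isLittleO_pow_log_id_atTop (n := 2)).bound (by norm_num : (0 : ℝ) < 1 / 525)
      filter_upwards [this, Filter.eventually_ge_atTop 0] with x hx hx0
      simp only [id, norm_eq_abs, abs_of_nonneg hx0, abs_of_nonneg (sq_nonneg (log x))] at hx
      linarith
    filter_upwards [Filter.eventually_ge_atTop 1,
      (tendsto_log_atTop.comp tendsto_log_atTop).eventually_ge_atTop 1,
      tendsto_log_atTop.eventually h1] with N h1 h2 h3
    exact ⟨h1, h2, h3⟩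
  obtain ⟨N₀, hN₀⟩ := Filter.eventually_atTop.1 hev
  refine ⟨16 * C, 16, by positivity, by norm_num, N₀, fun N hN ↦ ?_⟩
  obtain ⟨hN1, hu1, huL⟩ := hN₀ N hN
  have hL1 : 1 ≤ log N := by nlinarith
  have hy : N ^ (1 / log (log N)) = exp (log N / log (log N)) := by
    rw [rpow_def_of_pos (by linarith), mul_one_div]
  rw [hy]
  refine (ncard_pairs_le N _ (C * log (log N) ^ 16 / log N ^ 2) (by positivity) hN1
    fun m b X hm hb hmb hX ↦ ?_).trans ?_
  · refine (hC N (by linarith) hu1 huL m b X hm hb hmb hX).trans_eq ?_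
    ring
  · have h1 : (1 + log N) ^ 2 ≤ (2 * log N) ^ 2 := by gcongr; linarith
    rw [show (16 : ℝ) = ((16 : ℕ) : ℝ) by norm_num, rpow_natCast]
    calc _ ≤ 4 * (C * log (log N) ^ 16 / log N ^ 2) * N * (2 * log N) ^ 2 := by gcongr
      _ = _ := by
          push_cast
          field_simp
          norm_num
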